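/- Let α be a nonempty cascading n-sequence whose last lower subinterval I_P satisfies max(I_P) = p. Then in RC(α) = (ν₁, ..., ν_n), every rigging of ν_q equals 0 for every q <= p - 1. -/

import Mathlib

namespace CascRC

abbrev RP := Multiset (ℕ × ℤ)
abbrev RC := ℕ → RP

/-- The Cartan matrix of type `A`. -/
def cartanA (a b : ℕ) : ℤ :=
  if a = b then 2 else if b = a + 1 ∨ a = b + 1 then -1 else 0

/-- The smallest rigging of a rigged partition (0 if empty). -/
noncomputable def minRig (ν : RP) : ℤ :=
  if h : ν = 0 then 0
  else (ν.map Prod.snd).toFinset.min'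
    (Multiset.toFinset_nonempty.mpr (by simpa [Multiset.map_eq_zero] using h))

/-- The greatest length of a string whose rigging is the smallest rigging. -/
noncomputable def selLen (ν : RP) : ℕ :=
  ((ν.filter (fun s => s.2 = minRig ν)).map Prod.fst).sup

/-- The Kashiwara operator `f_a` on rigged configurations. -/
noncomputable def fOp (a : ℕ) (R : RC) : RC :=
  if R a = 0 ∨ 0 < minRig (R a) then
    fun b => (if b = a then ({(1, -1)} : RP) else 0)
      + (R b).map (fun s => if 0 < s.1 then (s.1, s.2 - cartanA a b) else s)
  else
    fun b =>
      (if b = a then ({(selLen (R a) + 1, minRig (R a) - 1)} : RP) else 0)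
      + ((if b = a then (R a).erase (selLen (R a), minRig (R a)) else R b).map
          (fun s => if selLen (R a) < s.1 then (s.1, s.2 - cartanA a b) else s))

/-- A list `γ` acts by `f_γ = f_{γ_p} ∘ ⋯ ∘ f_{γ₁}`. -/
noncomputable def fList (γ : List ℕ) (R : RC) : RC :=
  γ.foldl (fun S a => fOp a S) R

def emptyRC : RC := fun _ => 0

/-- `RC(α)`: the result of the list `α` acting on the empty rigged configuration. -/
noncomputable def RCseq (α : List ℕ) : RC := fList α emptyRC

/-- The `m`-lower subinterval `(a, a+1, …, m)`. -/
def lowerInt (a m : ℕ) : List ℕ := List.range' a (m + 1 - a)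

def IsLowerIv (n : ℕ) (p : ℕ × ℕ) : Prop := 1 ≤ p.1 ∧ p.1 ≤ p.2 ∧ p.2 ≤ n

/-- Ordering between consecutive lower subintervals in a cascading sequence. -/
def CascCh (p q : ℕ × ℕ) : Prop := q.2 < p.2 ∨ (q.2 = p.2 ∧ p.1 ≤ q.1)

/-- `ivs` is the lower-subinterval decomposition of a cascading `n`-sequence. -/
def IsCascDecomp (n : ℕ) (ivs : List (ℕ × ℕ)) : Prop :=
  (∀ p ∈ ivs, IsLowerIv n p) ∧ ivs.Chain' CascCh

/-- The integer sequence determined by a decomposition into lower subintervals. -/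
def seqOf (ivs : List (ℕ × ℕ)) : List ℕ :=
  (ivs.map (fun p => lowerInt p.1 p.2)).flatten

/-- `R_k`: the rigged configuration corresponding to `I_1 ⋯ I_k`. -/
noncomputable def Rk (ivs : List (ℕ × ℕ)) (k : ℕ) : RC :=
  RCseq (seqOf (ivs.take k))

/-- Height of column `c` of (the underlying partition of) a rigged partition. -/
def colHt (ν : RP) (c : ℕ) : ℕ := (ν.filter (fun s => c ≤ s.1)).card

/-- Length of the `i`-th row (1-based) of the underlying partition. -/
def rowLen (ν : RP) (i : ℕ) : ℕ :=
  ((Finset.Icc 1 ((ν.map Prod.fst).sup)).filter (fun c => i ≤ colHt ν c)).card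

/-- Length of the uppermost row of length at most `L` (0 for the virtual empty row). -/
def upRowLen (ν : RP) (L : ℕ) : ℕ := rowLen ν (colHt ν (L + 1) + 1)

/-- The column to which an application of `f_a` adds a box. -/
noncomputable def selCol (a : ℕ) (R : RC) : ℕ :=
  if R a = 0 ∨ 0 < minRig (R a) then 1 else selLen (R a) + 1

/-- Given a lower subinterval `p = (a, m)` acting on `R`, the column to which the
operator `f_l` occurring in it adds a box in the `l`-th partition. -/
noncomputable def ivCol (p : ℕ × ℕ) (l : ℕ) (R : RC) : ℕ :=
  selCol l (fList (lowerInt p.1 (l - 1)) R)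

/-- Lengths `|r_a|, |r_{a+1}|, …` of the rows `r_i` of Lemma "snake":
`rLenSeq R a (i - a) = |r_i|`. -/
def rLenSeq (R : RC) (a : ℕ) : ℕ → ℕ
  | 0 => rowLen (R a) 1
  | k + 1 => upRowLen (R (a + k + 1)) (rLenSeq R a k)


/-- The underlying partition of a rigged partition, as a multiset of row lengths. -/
def lens (ν : RP) : Multiset ℕ := ν.map Prod.fst

/-- All strings have positive length, and the rigging of a string of length `x` is `h x`. -/
def HasRig (ν : RP) (h : ℕ → ℤ) : Prop := ∀ s ∈ ν, 0 < s.1 ∧ s.2 = h s.1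

/-- The change of riggings caused by adding a box to a row of length `y`. -/
def shift (y : ℕ) (k : ℤ) (s : ℕ × ℤ) : ℕ × ℤ := if y < s.1 then (s.1, s.2 - k) else s

lemma shift_fst (y : ℕ) (k : ℤ) (s : ℕ × ℤ) : (shift y k s).1 = s.1 := by
  unfold shift; split_ifs <;> rfl

lemma shift_snd (y : ℕ) (k : ℤ) (s : ℕ × ℤ) :
    (shift y k s).2 = s.2 - if y < s.1 then k else 0 := by
  unfold shift; split_ifs <;> simp

lemma mem_lens {ν : RP} {x : ℕ} : x ∈ lens ν ↔ ∃ s ∈ ν, s.1 = x := by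
  simp [lens]

lemma HasRig.mem {ν : RP} {h : ℕ → ℤ} (H : HasRig ν h) {x : ℕ} (hx : x ∈ lens ν) :
    0 < x ∧ (x, h x) ∈ ν := by
  obtain ⟨s, hs, rfl⟩ := mem_lens.1 hx
  obtain ⟨h0, h1⟩ := H s hs
  refine ⟨h0, ?_⟩
  rw [← h1]; exact hs

lemma HasRig.congr {ν : RP} {h h' : ℕ → ℤ} (H : HasRig ν h)
    (hh : ∀ x ∈ lens ν, h x = h' x) : HasRig ν h' := by
  intro s hs
  refine ⟨(H s hs).1, ?_⟩
  rw [(H s hs).2, hh _ (mem_lens.2 ⟨s, hs, rfl⟩)]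

lemma lens_map_shift (ν : RP) (y : ℕ) (k : ℤ) : lens (ν.map (shift y k)) = lens ν := by
  simp [lens, Multiset.map_map, shift_fst]

lemma HasRig.map_shift {ν : RP} {h : ℕ → ℤ} (H : HasRig ν h) (y : ℕ) (k : ℤ) :
    HasRig (ν.map (shift y k)) (fun x => h x - if y < x then k else 0) := by
  intro s hs
  obtain ⟨t, ht, rfl⟩ := Multiset.mem_map.1 hs
  rw [shift_snd, shift_fst, (H t ht).2]
  exact ⟨(H t ht).1, rfl⟩

lemma minRig_eq {ν : RP} {x : ℤ} (hx : ∃ s ∈ ν, s.2 = x) (hle : ∀ s ∈ ν, x ≤ s.2) :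
    minRig ν = x := by
  obtain ⟨s, hs, rfl⟩ := hx
  have h : ν ≠ 0 := by rintro rfl; simp at hs
  unfold minRig
  rw [dif_neg h]
  apply le_antisymm
  · apply Finset.min'_le
    simp only [Multiset.mem_toFinset, Multiset.mem_map]
    exact ⟨s, hs, rfl⟩
  · apply Finset.le_min'
    intro z hz
    simp only [Multiset.mem_toFinset, Multiset.mem_map] at hz
    obtain ⟨t, ht, rfl⟩ := hz
    exact hle t ht

lemma eq_zero_or_minRig_pos {ν : RP} (h : ∀ s ∈ ν, 0 < s.2) : ν = 0 ∨ 0 < minRig ν := by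
  by_cases h0 : ν = 0
  · exact Or.inl h0
  · right
    unfold minRig
    rw [dif_neg h0, Finset.lt_min'_iff]
    intro z hz
    simp only [Multiset.mem_toFinset, Multiset.mem_map] at hz
    obtain ⟨t, ht, rfl⟩ := hz
    exact h t ht

/-- `fOp` in terms of the length `y` of the row it extends, with `y = 0` for a new row. -/
lemma fOp_eq {a y : ℕ} {R : RC} {h : ℕ → ℤ} (H : HasRig (R a) h) (h0 : h 0 = 0)
    (hy : (y = 0 ∧ ∀ x ∈ lens (R a), 0 < h x) ∨
      (y ∈ lens (R a) ∧ h y ≤ 0 ∧ ∀ x ∈ lens (R a), h y ≤ h x ∧ (h x = h y → x ≤ y))) :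
    fOp a R = fun b => (if b = a then ({(y + 1, h y - 1)} : RP) else 0)
      + (if b = a then (R a).erase (y, h y) else R b).map (shift y (cartanA a b)) := by
  rcases hy with ⟨rfl, hpos⟩ | ⟨hmem, hle, hmin⟩
  · have hc : R a = 0 ∨ 0 < minRig (R a) := by
      apply eq_zero_or_minRig_pos
      intro s hs
      rw [(H s hs).2]
      exact hpos _ (mem_lens.2 ⟨s, hs, rfl⟩)
    have he : (R a).erase (0, h 0) = R a := by
      apply Multiset.erase_of_notMem
      intro hm
      exact absurd (H _ hm).1 (lt_irrefl 0)
    unfold fOp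
    rw [if_pos hc]
    funext b
    rw [he, h0]
    by_cases hb : b = a
    · subst hb; simp; rfl
    · simp [hb]; rfl
  · obtain ⟨ypos, hys⟩ := H.mem hmem
    have hm : minRig (R a) = h y := by
      apply minRig_eq ⟨_, hys, rfl⟩
      intro s hs
      rw [(H s hs).2]
      exact (hmin _ (mem_lens.2 ⟨s, hs, rfl⟩)).1
    have hl : selLen (R a) = y := by
      unfold selLen
      rw [hm]
      apply le_antisymm
      · rw [Multiset.sup_le]
        intro x hx
        simp only [Multiset.mem_map, Multiset.mem_filter] at hx
        obtain ⟨s, ⟨hs, hs2⟩, rfl⟩ := hx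
        rw [(H s hs).2] at hs2
        exact (hmin _ (mem_lens.2 ⟨s, hs, rfl⟩)).2 hs2
      · apply Multiset.le_sup
        simp only [Multiset.mem_map, Multiset.mem_filter]
        exact ⟨_, ⟨hys, rfl⟩, rfl⟩
    have hc : ¬ (R a = 0 ∨ 0 < minRig (R a)) := by
      rw [hm]
      rintro (h1 | h1)
      · rw [h1] at hys; simp at hys
      · omega
    unfold fOp
    rw [if_neg hc, hm, hl]
    rfl

lemma colHt_eq (ν : RP) (c : ℕ) : colHt ν c = ((lens ν).filter (c ≤ ·)).card := by
  simp [colHt, lens, Multiset.filter_map]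

lemma colHt_anti (ν : RP) {c d : ℕ} (h : c ≤ d) : colHt ν d ≤ colHt ν c :=
  Multiset.card_le_card (Multiset.monotone_filter_right _ fun _ hs => h.trans hs)

lemma colHt_eq_of_no_rows {ν : RP} {y L : ℕ} (h : ∀ x ∈ lens ν, x ≤ L → x ≤ y) {c : ℕ}
    (h1 : y < c) (h2 : c ≤ L + 1) : colHt ν c = colHt ν (L + 1) := by
  rw [colHt_eq, colHt_eq]
  congr 1
  apply Multiset.filter_congr
  intro x hx
  have := h x hx
  constructor <;> intro _ <;> omega

lemma no_row_of_colHt_eq {ν : RP} {x d : ℕ} (hd : x < d) (h : colHt ν d = colHt ν x) :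
    x ∉ lens ν := by
  intro hx
  have hle : (lens ν).filter (d ≤ ·) ≤ (lens ν).filter (x ≤ ·) :=
    Multiset.monotone_filter_right _ fun _ hs => hd.le.trans hs
  rw [colHt_eq, colHt_eq] at h
  have he := Multiset.eq_of_le_of_card_le hle h.ge
  have : x ∈ (lens ν).filter (d ≤ ·) := by
    rw [he]; exact Multiset.mem_filter.2 ⟨hx, le_rfl⟩
  have := (Multiset.mem_filter.1 this).2
  omega

lemma colHt_congr {ν μ : RP} (h : lens ν = lens μ) (c : ℕ) : colHt ν c = colHt μ c := by
  rw [colHt_eq, colHt_eq, h]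

lemma colHt_add_box {ν μ : RP} {y : ℕ} (h : lens μ = (y + 1) ::ₘ (lens ν).erase y)
    (hy : y = 0 ∨ y ∈ lens ν) {c : ℕ} (hc : 1 ≤ c) :
    colHt μ c = colHt ν c + if c = y + 1 then 1 else 0 := by
  rw [colHt_eq, colHt_eq, h]
  by_cases hm : y ∈ lens ν
  · obtain ⟨t, ht⟩ := Multiset.exists_cons_of_mem hm
    rw [ht, Multiset.erase_cons_head, Multiset.filter_cons, Multiset.filter_cons]
    simp only [Multiset.card_add]
    split_ifs <;> simp <;> omega
  · have hy0 : y = 0 := by tauto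
    subst hy0
    rw [Multiset.erase_of_notMem hm, Multiset.filter_cons]
    simp only [Multiset.card_add]
    split_ifs <;> simp <;> omega

/-- There is a longest row of length at most `L`, with `0` standing for the empty row. -/
lemma exists_longest (M : Multiset ℕ) (L : ℕ) :
    ∃ y ≤ L, (y = 0 ∨ y ∈ M) ∧ ∀ x ∈ M, x ≤ L → x ≤ y := by
  induction L with
  | zero => exact ⟨0, le_rfl, Or.inl rfl, fun x _ h => h⟩
  | succ L ih =>
    by_cases h : L + 1 ∈ M
    · exact ⟨L + 1, le_rfl, Or.inr h, fun x _ h => h⟩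
    · obtain ⟨y, h1, h2, h3⟩ := ih
      refine ⟨y, by omega, h2, fun x hx hxL => h3 x hx ?_⟩
      have : x ≠ L + 1 := fun e => h (e ▸ hx)
      omega

/-- The effect of `f_a` on `ν_a` when its riggings are `G` shifted up by one beyond length `L`:
it extends the longest row of length at most `L`. -/
lemma fOp_step {a L : ℕ} {R : RC} {G : ℕ → ℤ}
    (H : HasRig (R a) (fun x => G x + if L < x then 1 else 0)) (hG0 : G 0 = 0)
    (hGle : ∀ x, G x ≤ 0)
    (hG : (∀ x, G x = 0) ∨
      ∃ e, e + 1 ∈ lens (R a) ∧ e + 1 ≤ L ∧ ∀ x y, e < x → G x ≤ G y) :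
    ∃ y ≤ L, (y = 0 ∨ y ∈ lens (R a)) ∧ (∀ x ∈ lens (R a), x ≤ L → x ≤ y) ∧
      HasRig (fOp a R a) (fun x => G x - if y < x then 1 else 0) ∧
      lens (fOp a R a) = (y + 1) ::ₘ (lens (R a)).erase y ∧
      ∀ b, b ≠ a → fOp a R b = (R b).map (shift y (cartanA a b)) := by
  obtain ⟨y, hyL, hy, hmax⟩ := exists_longest (lens (R a)) L
  have hGy : ∀ x z, y ≤ x → G x ≤ G z := by
    rcases hG with hG | ⟨e, he, heL, hmin⟩
    · intro x z _; rw [hG, hG]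
    · have := hmax _ he heL
      intro x z hx; exact hmin x z (by omega)
  have key := fOp_eq (y := y) H (by simp [hG0]) (by
    by_cases hmem : y ∈ lens (R a)
    · right
      refine ⟨hmem, ?_, ?_⟩
      · simpa [not_lt.2 hyL] using hGle y
      · intro x hx
        have h1 := hGy y x le_rfl
        have h2 := hmax x hx
        rw [if_neg (by omega : ¬ L < y)]
        by_cases hxL : L < x
        · rw [if_pos hxL]
          exact ⟨by omega, fun h => by omega⟩
        · rw [if_neg hxL]
          exact ⟨by omega, fun _ => h2 (by omega)⟩
    · left
      have hy0 : y = 0 := by tauto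
      refine ⟨hy0, fun x hx => ?_⟩
      have h1 := hGy 0 x (by omega)
      have h2 := hmax x hx
      have h3 := (H.mem hx).1
      rw [if_pos (by omega)]
      omega)
  simp only [if_neg (not_lt.2 hyL), add_zero] at key
  have hlens : lens (fOp a R a) = (y + 1) ::ₘ (lens (R a)).erase y := by
    rw [key]
    simp only [if_true]
    have : lens ((R a).erase (y, G y)) = (lens (R a)).erase y := by
      by_cases hmem : y ∈ lens (R a)
      · have := (H.mem hmem).2
        simp only [if_neg (not_lt.2 hyL), add_zero] at this
        exact Multiset.map_erase_of_mem _ _ this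
      · rw [Multiset.erase_of_notMem hmem, Multiset.erase_of_notMem]
        exact fun h => hmem (mem_lens.2 ⟨_, h, rfl⟩)
    rw [← this, ← lens_map_shift ((R a).erase (y, G y)) y (cartanA a a)]
    simp only [lens, Multiset.singleton_add, Multiset.map_cons]
  refine ⟨y, hyL, hy, hmax, ?_, hlens, fun b hb => by simp [key, hb]⟩
  intro s hs
  rw [key] at hs
  simp only [if_true, Multiset.mem_add, Multiset.mem_singleton, Multiset.mem_map] at hs
  rcases hs with rfl | ⟨t, ht, rfl⟩
  · refine ⟨by simp, ?_⟩
    have h1 := hGy y (y + 1) le_rfl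
    have h2 := hGy (y + 1) y (by omega)
    simp only [lt_add_one, if_true]
    omega
  · have ht' := Multiset.mem_of_mem_erase ht
    obtain ⟨h1, h2⟩ := H t ht'
    have h3 := hmax t.1 (mem_lens.2 ⟨t, ht', rfl⟩)
    rw [shift_snd, shift_fst, h2]
    refine ⟨h1, ?_⟩
    simp only [cartanA, if_true]
    split_ifs <;> omega

/-- The riggings of `ν_j` before an interval with maximum `m` acts: `0` for `j < m`, and
`G` for `j = m`. -/
def rigAt (m : ℕ) (G : ℕ → ℤ) (j x : ℕ) : ℤ := if j = m then G x else 0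

/-- Consecutive partitions differ by at most one box in each column. -/
def Interlace (ν μ : RP) : Prop :=
  ∀ c, 1 ≤ c → colHt ν c ≤ colHt μ c ∧ colHt μ c ≤ colHt ν c + 1

/-- Configurations on which an interval `(a, …, m)` may act; `G` gives the riggings of `ν_m`. -/
structure Ready (R : RC) (a m : ℕ) (G : ℕ → ℤ) : Prop where
  rig : ∀ j, 1 ≤ j → j ≤ m → HasRig (R j) (rigAt m G j)
  inter : ∀ j, 1 ≤ j → j + 1 ≤ m → Interlace (R j) (R (j + 1))
  zero : G 0 = 0
  nonpos : ∀ x, G x ≤ 0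
  last : (∀ x, G x = 0) ∨ ∃ e : ℕ → ℕ, (∀ j, a ≤ j → j ≤ m → e j + 1 ∈ lens (R j)) ∧
    (∀ j, a ≤ j → j < m → e (j + 1) ≤ e j) ∧ ∀ x y, e m < x → G x ≤ G y

/-- Configurations occurring after `f_a, …, f_i` of an interval `(a, …, m)` have acted,
`f_i` having extended a row of length `l`. -/
structure Partway (R : RC) (a m : ℕ) (G : ℕ → ℤ) (i l : ℕ) : Prop where
  low : ∀ j, 1 ≤ j → j < i → HasRig (R j) (fun _ => 0)
  cur : 1 ≤ i → HasRig (R i) (fun x => rigAt m G i x - if l < x then 1 else 0)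
  next : i + 1 ≤ m → HasRig (R (i + 1)) (fun x => rigAt m G (i + 1) x + if l < x then 1 else 0)
  high : ∀ j, i + 1 < j → j ≤ m → HasRig (R j) (rigAt m G j)
  inter : ∀ j, 1 ≤ j → j + 1 ≤ m → j ≠ i → Interlace (R j) (R (j + 1))
  inter_cur : 1 ≤ i → i + 1 ≤ m → ∀ c, 1 ≤ c →
    colHt (R i) c ≤ colHt (R (i + 1)) c + (if c = l + 1 then 1 else 0) ∧
    colHt (R (i + 1)) c + (if c = l + 1 then 1 else 0) ≤ colHt (R i) c + 1
  zero : G 0 = 0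
  nonpos : ∀ x, G x ≤ 0
  new : ∃ e : ℕ → ℕ, (∀ j, a ≤ j → j ≤ i → e j + 1 ∈ lens (R j)) ∧
    (∀ j, a ≤ j → j < i → e (j + 1) ≤ e j) ∧ (a ≤ i → e i = l)
  old : i + 1 ≤ m → (∀ x, G x = 0) ∨
    ∃ e : ℕ → ℕ, (∀ j, i + 1 ≤ j → j ≤ m → e j + 1 ∈ lens (R j)) ∧
      (∀ j, i + 1 ≤ j → j < m → e (j + 1) ≤ e j) ∧ e (i + 1) + 1 ≤ l ∧
      ∀ x y, e m < x → G x ≤ G y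
  final : i = m → ∀ x y, l < x → G x ≤ G y

lemma exists_row_bound (M : Multiset ℕ) : ∃ l, ∀ x ∈ M, x ≤ l :=
  ⟨M.sup, fun _ hx => Multiset.le_sup hx⟩

lemma colHt_eq_zero {ν : RP} {c : ℕ} (h : ∀ x ∈ lens ν, x < c) : colHt ν c = 0 := by
  rw [colHt_eq, Multiset.card_eq_zero, Multiset.filter_eq_nil]
  intro x hx
  have := h x hx
  omega

lemma Ready.partway {R : RC} {i m : ℕ} {G : ℕ → ℤ} (H : Ready R (i + 1) m G) (him : i + 1 ≤ m) :
    ∃ l, Partway R (i + 1) m G i l := by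
  obtain ⟨l₁, hl₁⟩ := exists_row_bound (lens (R i))
  obtain ⟨l₂, hl₂⟩ := exists_row_bound (lens (R (i + 1)))
  refine ⟨max l₁ l₂, ?_⟩
  have hl₁' : ∀ x ∈ lens (R i), ¬ max l₁ l₂ < x := fun x hx => by have := hl₁ x hx; omega
  have hl₂' : ∀ x ∈ lens (R (i + 1)), ¬ max l₁ l₂ < x := fun x hx => by
    have := hl₂ x hx; omega
  refine ⟨?_, ?_, ?_, ?_, ?_, ?_, H.zero, H.nonpos, ?_, ?_, ?_⟩
  · intro j h1 h2
    refine (H.rig j h1 (by omega)).congr fun x _ => ?_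
    rw [rigAt, if_neg (by omega)]
  · intro h1
    refine (H.rig i h1 (by omega)).congr fun x hx => ?_
    simp [hl₁' x hx]
  · intro _
    refine (H.rig (i + 1) (by omega) him).congr fun x hx => ?_
    simp [hl₂' x hx]
  · intro j h1 h2
    exact H.rig j (by omega) h2
  · intro j h1 h2 _
    exact H.inter j h1 h2
  · intro h1 _ c hc
    have := H.inter i h1 him c hc
    by_cases hcl : c = max l₁ l₂ + 1
    · have e1 : colHt (R i) c = 0 := colHt_eq_zero fun x hx => by have := hl₁' x hx; omega
      have e2 : colHt (R (i + 1)) c = 0 :=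
        colHt_eq_zero fun x hx => by have := hl₂' x hx; omega
      rw [if_pos hcl]; omega
    · rw [if_neg hcl]; omega
  · exact ⟨fun _ => 0, by omega, by omega, by omega⟩
  · intro _
    rcases H.last with h | ⟨e, h1, h2, h3⟩
    · exact Or.inl h
    · refine Or.inr ⟨e, h1, h2, ?_, h3⟩
      have := hl₂' _ (h1 (i + 1) le_rfl him)
      omega
  · omega

lemma Partway.step {R : RC} {a i m l : ℕ} {G : ℕ → ℤ} (H : Partway R a m G i l)
    (hai : a ≤ i + 1) (him : i + 1 ≤ m) :
    ∃ y, Partway (fOp (i + 1) R) a m G (i + 1) y := by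
  obtain ⟨y, hyl, hy, hmax, hrig, hlens, hother⟩ :=
    fOp_step (G := rigAt m G (i + 1)) (H.next him)
      (by simp [rigAt, H.zero])
      (by intro x; unfold rigAt; split_ifs; exacts [H.nonpos x, le_rfl])
      (by
        by_cases hm : i + 1 = m
        · subst hm
          rcases H.old le_rfl with h | ⟨e, h1, _, h3, h4⟩
          · left; intro x; simp [rigAt, h]
          · right
            refine ⟨e (i + 1), h1 _ le_rfl le_rfl, h3, fun x z hx => ?_⟩
            simpa [rigAt] using h4 x z hx
        · left; intro x; simp [rigAt, hm])
  refine ⟨y, ?_⟩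
  have lens_other : ∀ b, b ≠ i + 1 → lens (fOp (i + 1) R b) = lens (R b) := by
    intro b hb; rw [hother b hb, lens_map_shift]
  have col_other : ∀ b, b ≠ i + 1 → ∀ c, colHt (fOp (i + 1) R b) c = colHt (R b) c :=
    fun b hb c => colHt_congr (lens_other b hb) c
  have col_new : ∀ c, 1 ≤ c → colHt (fOp (i + 1) R (i + 1)) c =
      colHt (R (i + 1)) c + if c = y + 1 then 1 else 0 :=
    fun c hc => colHt_add_box hlens hy hc
  have rig_far : ∀ b h, b ≠ i → b ≠ i + 1 → b ≠ i + 2 → HasRig (R b) h →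
      HasRig (fOp (i + 1) R b) h := by
    intro b h h1 h2 h3 hb
    rw [hother b h2]
    refine (hb.map_shift _ _).congr fun x _ => ?_
    simp [cartanA, Ne.symm h2, h3, Ne.symm h1]
  have mem_new : y + 1 ∈ lens (fOp (i + 1) R (i + 1)) := by rw [hlens]; simp
  have col_const : ∀ c, y < c → c ≤ l + 1 → colHt (R (i + 1)) c = colHt (R (i + 1)) (l + 1) :=
    fun c h1 h2 => colHt_eq_of_no_rows hmax h1 h2
  have col_cur : 1 ≤ i → y < l → ∀ c, y < c → c ≤ l + 1 →
      colHt (R i) c = colHt (R (i + 1)) (l + 1) := by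
    intro hi hyl' c h1 h2
    have hL := H.inter_cur hi him (l + 1) (by omega)
    rw [if_pos rfl] at hL
    have hl0 := H.inter_cur hi him l (by omega)
    rw [if_neg (by omega), col_const l hyl' (by omega)] at hl0
    have m1 := colHt_anti (R i) (show l ≤ l + 1 by omega)
    by_cases hc : c = l + 1
    · rw [hc]; omega
    · have hc0 := H.inter_cur hi him c (by omega)
      rw [if_neg hc, col_const c h1 h2] at hc0
      have m2 := colHt_anti (R i) h2
      omega
  refine ⟨?_, fun _ => hrig, ?_, ?_, ?_, ?_, H.zero, H.nonpos, ?_, ?_, ?_⟩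
  · intro j h1 h2
    by_cases hj : j = i
    · subst hj
      rw [hother j (by omega)]
      refine ((H.cur h1).map_shift _ _).congr fun x hx => ?_
      rw [lens_map_shift] at hx
      have hno : ¬ (y < x ∧ x ≤ l) := by
        rintro ⟨h3, h4⟩
        refine no_row_of_colHt_eq (show x < l + 1 by omega) ?_ hx
        rw [col_cur h1 (by omega) x h3 (by omega), col_cur h1 (by omega) (l + 1) (by omega) le_rfl]
      have hx0 : ¬ (l < x ∧ ¬ y < x) := by omega
      simp only [rigAt, cartanA, if_neg (show ¬ j = m by omega), if_neg (show ¬ j + 1 = j by omega),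
        or_true, if_true]
      split_ifs <;> first | rfl | omega
    · exact rig_far j _ hj (by omega) (by omega) (H.low j h1 (by omega))
  · intro h1
    rw [hother _ (by omega)]
    refine ((H.high (i + 1 + 1) (by omega) h1).map_shift _ _).congr fun x _ => ?_
    simp only [cartanA, if_neg (show ¬ i + 1 = i + 1 + 1 by omega), true_or, if_true]
    split_ifs <;> omega
  · intro j h1 h2
    exact rig_far j _ (by omega) (by omega) (by omega) (H.high j (by omega) h2)
  · intro j h1 h2 h3 c hc
    by_cases hj : j = i
    · subst hj
      rw [col_new c hc, col_other j (by omega)]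
      have h4 := H.inter_cur h1 him c hc
      by_cases hyl' : y = l
      · rw [hyl']; exact h4
      · by_cases hcy : y < c ∧ c ≤ l + 1
        · rw [col_cur h1 (by omega) c hcy.1 hcy.2, col_const c hcy.1 hcy.2]
          split_ifs <;> omega
        · rw [if_neg (by omega)] at h4 ⊢
          exact h4
    · rw [col_other j h3, col_other (j + 1) (by omega)]
      exact H.inter j h1 h2 hj c hc
  · intro _ h2 c hc
    rw [col_new c hc, col_other (i + 1 + 1) (by omega)]
    have := H.inter (i + 1) (by omega) h2 (by omega) c hc
    omega
  · obtain ⟨e, h1, h2, h3⟩ := H.new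
    refine ⟨Function.update e (i + 1) y, ?_, ?_, fun _ => by simp⟩
    · intro j hj1 hj2
      by_cases hj : j = i + 1
      · subst hj; simpa using mem_new
      · rw [Function.update_of_ne hj, lens_other j hj]
        exact h1 j hj1 (by omega)
    · intro j hj1 hj2
      rw [Function.update_of_ne (by omega : j ≠ i + 1)]
      by_cases hj : j = i
      · subst hj
        rw [Function.update_self, h3 hj1]; exact hyl
      · rw [Function.update_of_ne (by omega)]
        exact h2 j hj1 (by omega)
  · intro hm
    rcases H.old him with h | ⟨e, h1, h2, h3, h4⟩
    · exact Or.inl h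
    · refine Or.inr ⟨e, ?_, fun j hj1 hj2 => h2 j (by omega) hj2, ?_, h4⟩
      · intro j hj1 hj2
        rw [lens_other j (by omega)]
        exact h1 j (by omega) hj2
      · have := hmax _ (h1 (i + 1) le_rfl him) h3
        have := h2 (i + 1) le_rfl (by omega)
        omega
  · intro hm x z hx
    rcases H.old him with h | ⟨e, h1, h2, h3, h4⟩
    · rw [h, h]
    · have := hmax _ (h1 (i + 1) le_rfl him) h3
      subst hm
      exact h4 x z (by omega)

lemma Partway.ready {R : RC} {a m l : ℕ} {G : ℕ → ℤ} (H : Partway R a m G m l) (ham : a ≤ m) :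
    Ready R a m (fun x => G x - if l < x then 1 else 0) := by
  refine ⟨?_, fun j h1 h2 => H.inter j h1 h2 (by omega), ?_, ?_, ?_⟩
  · intro j h1 h2
    by_cases hj : j = m
    · subst hj
      refine (H.cur h1).congr fun x _ => ?_
      simp [rigAt]
    · refine (H.low j h1 (by omega)).congr fun x _ => ?_
      simp [rigAt, hj]
  · simp [H.zero]
  · intro x
    have := H.nonpos x
    split_ifs <;> omega
  · obtain ⟨e, h1, h2, h3⟩ := H.new
    refine Or.inr ⟨e, h1, h2, fun x y hx => ?_⟩
    rw [h3 ham] at hx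
    have := H.final rfl x y hx
    split_ifs <;> omega

lemma Partway.run {a m : ℕ} {G : ℕ → ℤ} (k : ℕ) : ∀ {R : RC} {i l : ℕ}, Partway R a m G i l →
    a ≤ i + 1 → i + k = m → ∃ l', Partway (fList (List.range' (i + 1) k) R) a m G m l' := by
  induction k with
  | zero =>
    intro R i l H _ hk
    obtain rfl : i = m := by omega
    exact ⟨l, H⟩
  | succ k ih =>
    intro R i l H hai hk
    obtain ⟨y, Hy⟩ := H.step hai (by omega)
    obtain ⟨l', H'⟩ := ih Hy (by omega) (by omega)
    exact ⟨l', by simpa [List.range'_succ, fList] using H'⟩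

lemma Ready.interval {R : RC} {a m : ℕ} {G : ℕ → ℤ} (H : Ready R a m G) (ha : 1 ≤ a)
    (ham : a ≤ m) : ∃ G', Ready (fList (lowerInt a m) R) a m G' := by
  obtain ⟨i, rfl⟩ : ∃ i, a = i + 1 := ⟨a - 1, by omega⟩
  obtain ⟨l, Hl⟩ := H.partway ham
  obtain ⟨l', H'⟩ := Hl.run (m - i) le_rfl (by omega)
  refine ⟨_, Partway.ready (l := l') (G := G) ?_ ham⟩
  rw [lowerInt, show m + 1 - (i + 1) = m - i by omega]
  exact H'

lemma Ready.of_cascCh {R : RC} {a m a' m' : ℕ} {G : ℕ → ℤ} (H : Ready R a m G)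
    (h : CascCh (a, m) (a', m')) : ∃ G', Ready R a' m' G' := by
  rcases h with h | ⟨h1, h2⟩
  · dsimp only at h
    refine ⟨fun _ => 0, ?_, fun j h1 h2 => H.inter j h1 (by omega), rfl, fun _ => le_rfl,
      Or.inl fun _ => rfl⟩
    intro j h1 h2
    refine (H.rig j h1 (by omega)).congr fun x _ => ?_
    simp [rigAt, show j ≠ m by omega]
  · dsimp only at h1 h2
    subst h1
    refine ⟨G, H.rig, H.inter, H.zero, H.nonpos, ?_⟩
    rcases H.last with h | ⟨e, h3, h4, h5⟩
    · exact Or.inl h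
    · exact Or.inr ⟨e, fun j hj => h3 j (by omega), fun j hj => h4 j (by omega), h5⟩

lemma ready_emptyRC (a m : ℕ) : Ready emptyRC a m (fun _ => 0) := by
  refine ⟨?_, ?_, rfl, fun _ => le_rfl, Or.inl fun _ => rfl⟩
  · intro j _ _ s hs
    simp [emptyRC] at hs
  · intro j _ _ c _
    simp [emptyRC]

lemma ready_of_chain {n : ℕ} : ∀ (ivs : List (ℕ × ℕ)) (R : RC) (q : ℕ × ℕ) (G : ℕ → ℤ),
    Ready R q.1 q.2 G → (∀ p ∈ q :: ivs, IsLowerIv n p) → (q :: ivs).IsChain CascCh →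
    ∃ G', Ready (fList (seqOf (q :: ivs)) R) ((q :: ivs).getLast (by simp)).1
      ((q :: ivs).getLast (by simp)).2 G' := by
  intro ivs
  induction ivs with
  | nil =>
    intro R q G H hlow _
    obtain ⟨h1, h2, _⟩ := hlow q (by simp)
    simpa [seqOf] using H.interval h1 h2
  | cons r ivs ih =>
    intro R q G H hlow hch
    obtain ⟨h1, h2, _⟩ := hlow q (by simp)
    obtain ⟨G₁, H₁⟩ := H.interval h1 h2
    rw [List.isChain_cons_cons] at hch
    obtain ⟨G₂, H₂⟩ := H₁.of_cascCh hch.1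
    obtain ⟨G₃, H₃⟩ := ih _ r G₂ H₂ (fun p hp => hlow p (List.mem_cons_of_mem _ hp)) hch.2
    refine ⟨G₃, ?_⟩
    rw [List.getLast_cons (by simp)]
    simpa [seqOf, fList, List.foldl_append] using H₃

/-- If `α` is a nonempty cascading `n`-sequence whose last lower subinterval has maximum
`p`, then in `RC(α) = (ν₁, …, ν_n)` every rigging of `ν_q` is `0` for `q ≤ p - 1`. -/
theorem riggings_zero_below_last (n : ℕ) (hn : 0 < n)
    (ivs : List (ℕ × ℕ)) (hc : IsCascDecomp n ivs)
    (hne : ivs ≠ []) (p : ℕ) (hp : (ivs.getLast hne).2 = p) :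
    ∀ q, 1 ≤ q → q ≤ p - 1 → ∀ s ∈ RCseq (seqOf ivs) q, s.2 = 0 := by
  obtain ⟨hlow, hch⟩ := hc
  cases ivs with
  | nil => exact absurd rfl hne
  | cons r ivs =>
    obtain ⟨G, H⟩ := ready_of_chain ivs emptyRC r _ (ready_emptyRC _ _) hlow hch
    rw [hp] at H
    intro q h1 h2 s hs
    have h := (H.rig q h1 (by omega) s hs).2
    rwa [rigAt, if_neg (by omega)] at h

end CascRC
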